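/- arXiv:1811.00886 — 2 statements merged into one kernel-verified Lean document; each statement's English description precedes it below -/
import Mathlib

section
/- Define f : [0,1] × [0,1] → [0,1] by f(x,y) = x if y ≤ 1/2 or x ≥ 1/2, and f(x,y) = (1/2)·(2x)^{1+(y−1/2)} if x ≤ 1/2 and y ≥ 1/2. Then for every x ∈ [0,1/2] and every ε, ε′ ∈ (0,1/2], writing y = 1/2 + ε′ and z = 1/2 + ε, one has f(f(x,y),z) = (1/2)·(2x)^{(1+ε)(1+ε′)} and also f(f(x,z),f(y,z)) = (1/2)·(2x)^{(1+ε)(1+ε′)}. -/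
open Set

/-- The quandle operation of Theorem 3.3: `f x y = x` if `y ≤ 1/2` or `x ≥ 1/2`,
and `f x y = (1/2)·(2x)^(1+(y-1/2))` otherwise (real power). -/
noncomputable def f01 (x y : ℝ) : ℝ :=
  if y ≤ 1 / 2 ∨ 1 / 2 ≤ x then x else 1 / 2 * (2 * x) ^ (1 + (y - 1 / 2))

/-- On `x ≤ 1/2`, `y > 1/2` the operation is the power formula, including at `x = 1/2`. -/
theorem f01_half_add {x ε : ℝ} (hx : x ≤ 1 / 2) (hε : 0 < ε) :
    f01 x (1 / 2 + ε) = 1 / 2 * (2 * x) ^ (1 + ε) := by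
  have hy : ¬ 1 / 2 + ε ≤ 1 / 2 := by linarith
  rcases hx.eq_or_lt with rfl | hx
  · norm_num [f01]
  · rw [f01, if_neg (not_or.2 ⟨hy, hx.not_ge⟩), add_sub_cancel_left]

theorem f01_of_half_le {x : ℝ} (y : ℝ) (hx : 1 / 2 ≤ x) : f01 x y = x :=
  if_pos (Or.inr hx)

theorem f01_f01_half_add {x ε ε' : ℝ} (hx₀ : 0 ≤ x) (hx : x ≤ 1 / 2) (hε : 0 < ε)
    (hε' : 0 < ε') :
    f01 (f01 x (1 / 2 + ε')) (1 / 2 + ε) = 1 / 2 * (2 * x) ^ ((1 + ε) * (1 + ε')) := by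
  have h2x : 0 ≤ 2 * x := by linarith
  have hpow : (2 * x) ^ (1 + ε') ≤ 1 :=
    Real.rpow_le_one h2x (by linarith) (by linarith)
  rw [f01_half_add hx hε', f01_half_add (by linarith) hε, ← mul_assoc,
    mul_one_div_cancel two_ne_zero, one_mul, ← Real.rpow_mul h2x, mul_comm (1 + ε')]

/-- Case 4 of the distributivity proof: for `x ∈ [0,1/2]`, `ε, ε' ∈ (0,1/2]`, with
`y = 1/2 + ε'` and `z = 1/2 + ε`, both `f(f(x,y),z)` and `f(f(x,z),f(y,z))` equal
`(1/2)·(2x)^((1+ε)(1+ε'))`. -/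
theorem stmt5 :
    ∀ x ∈ Icc (0 : ℝ) (1 / 2), ∀ ε ∈ Ioc (0 : ℝ) (1 / 2), ∀ ε' ∈ Ioc (0 : ℝ) (1 / 2),
      f01 (f01 x (1 / 2 + ε')) (1 / 2 + ε) = 1 / 2 * (2 * x) ^ ((1 + ε) * (1 + ε')) ∧
      f01 (f01 x (1 / 2 + ε)) (f01 (1 / 2 + ε') (1 / 2 + ε)) =
        1 / 2 * (2 * x) ^ ((1 + ε) * (1 + ε')) := by
  intro x hx ε hε ε' hε'
  refine ⟨f01_f01_half_add hx.1 hx.2 hε.1 hε'.1, ?_⟩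
  rw [f01_of_half_le (x := 1 / 2 + ε') _ (by linarith [hε'.1]),
    f01_f01_half_add hx.1 hx.2 hε'.1 hε.1, mul_comm (1 + ε')]
end

section
/- Let a < b be real numbers and set m = (a+b)/2. Define f_{[a,b]} : [a,b] × [a,b] → [a,b] by f_{[a,b]}(x,y) = x if y ≤ m or x ≥ m, and f_{[a,b]}(x,y) = a + ((b−a)/2)·( (2/(b−a))·(x−a) )^{1+(y−m)} if x ≤ m and y ≥ m. Then f_{[a,b]} is a nontrivial topological quandle operation on [a,b]: it is continuous, f_{[a,b]}(x,x) = x for all x, f_{[a,b]}(f_{[a,b]}(x,y),z) = f_{[a,b]}(f_{[a,b]}(x,z),f_{[a,b]}(y,z)) for all x, y, z, each right translation x ↦ f_{[a,b]}(x,y) is a homeomorphism of [a,b], and f_{[a,b]}(x₀,y₀) ≠ x₀ for some x₀, y₀. -/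
open Set

/-- The quandle operation `f_{[a,b]}` of Remark 3.5 on the closed interval `[a,b]`:
`f x y = x` if `y ≤ (a+b)/2` or `x ≥ (a+b)/2`, and otherwise
`f x y = a + ((b-a)/2)·((2/(b-a))·(x-a))^(1+(y-(a+b)/2))` (real power). -/
noncomputable def fab (a b : ℝ) (x y : ℝ) : ℝ :=
  if y ≤ (a + b) / 2 ∨ (a + b) / 2 ≤ x then x
  else a + (b - a) / 2 * ((2 / (b - a)) * (x - a)) ^ (1 + (y - (a + b) / 2))

/-- The power map of exponent `s` on the left half of `[a,b]`, rescaled from `[0,1]`, and the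
identity on the right half. -/
noncomputable def halfPow (a b s x : ℝ) : ℝ :=
  if (a + b) / 2 ≤ x then x else a + (b - a) / 2 * ((2 / (b - a)) * (x - a)) ^ s

/-- The exponent by which `y` acts in `fab a b`. -/
noncomputable def fabExponent (a b y : ℝ) : ℝ := 1 + max (y - (a + b) / 2) 0

lemma fabExponent_pos (a b y : ℝ) : 0 < fabExponent a b y := by
  have := le_max_right (y - (a + b) / 2) 0
  unfold fabExponent
  linarith

lemma rescale_symm {a b : ℝ} (hab : a < b) (x : ℝ) :
    a + (b - a) / 2 * ((2 / (b - a)) * (x - a)) = x := by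
  have : b - a ≠ 0 := (sub_pos.2 hab).ne'
  field_simp
  ring

lemma halfPow_one {a b : ℝ} (hab : a < b) (x : ℝ) : halfPow a b 1 x = x := by
  unfold halfPow
  split_ifs with h
  · rfl
  · rw [Real.rpow_one, rescale_symm hab]

lemma fab_eq_halfPow {a b : ℝ} (hab : a < b) (x y : ℝ) :
    fab a b x y = halfPow a b (fabExponent a b y) x := by
  by_cases hy : y ≤ (a + b) / 2
  · rw [fabExponent, max_eq_right (by linarith), add_zero, halfPow_one hab, fab,
      if_pos (Or.inl hy)]
  · rw [fabExponent, max_eq_left (by linarith)]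
    simp only [fab, halfPow, hy, false_or]

lemma halfPow_of_le {a b s x : ℝ} (hx : (a + b) / 2 ≤ x) : halfPow a b s x = x :=
  if_pos hx

lemma halfPow_of_lt {a b s x : ℝ} (hx : x < (a + b) / 2) :
    halfPow a b s x = a + (b - a) / 2 * ((2 / (b - a)) * (x - a)) ^ s :=
  if_neg hx.not_ge

lemma rescale_nonneg {a b x : ℝ} (hab : a < b) (hx : a ≤ x) : 0 ≤ (2 / (b - a)) * (x - a) :=
  mul_nonneg (div_nonneg zero_le_two (sub_pos.2 hab).le) (sub_nonneg.2 hx)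

lemma rescale_lt_one {a b x : ℝ} (hab : a < b) (hx : x < (a + b) / 2) :
    (2 / (b - a)) * (x - a) < 1 := by
  have : 0 < b - a := sub_pos.2 hab
  rw [div_mul_eq_mul_div, div_lt_one this]
  linarith

lemma le_halfPow {a b x : ℝ} (hab : a < b) (s : ℝ) (hx : a ≤ x) : a ≤ halfPow a b s x := by
  unfold halfPow
  split_ifs
  · exact hx
  · have := mul_nonneg (half_pos (sub_pos.2 hab)).le (Real.rpow_nonneg (rescale_nonneg hab hx) s)
    linarith

lemma halfPow_lt {a b s x : ℝ} (hab : a < b) (hs : 0 < s) (hx : a ≤ x) (hxm : x < (a + b) / 2) :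
    halfPow a b s x < (a + b) / 2 := by
  rw [halfPow_of_lt hxm]
  have h := mul_lt_mul_of_pos_left
    (Real.rpow_lt_one (rescale_nonneg hab hx) (rescale_lt_one hab hxm) hs)
    (half_pos (sub_pos.2 hab))
  linarith

lemma halfPow_mem_Icc {a b s x : ℝ} (hab : a < b) (hs : 0 < s) (hx : x ∈ Icc a b) :
    halfPow a b s x ∈ Icc a b := by
  refine ⟨le_halfPow hab s hx.1, ?_⟩
  rcases lt_or_ge x ((a + b) / 2) with h | h
  · linarith [halfPow_lt hab hs hx.1 h]
  · rw [halfPow_of_le h]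
    exact hx.2

lemma halfPow_halfPow {a b s r x : ℝ} (hab : a < b) (hs : 0 < s) (hx : a ≤ x) :
    halfPow a b r (halfPow a b s x) = halfPow a b (s * r) x := by
  rcases lt_or_ge x ((a + b) / 2) with h | h
  · have hba : b - a ≠ 0 := (sub_pos.2 hab).ne'
    rw [halfPow_of_lt (halfPow_lt hab hs hx h), halfPow_of_lt h, halfPow_of_lt h,
      Real.rpow_mul (rescale_nonneg hab hx), add_sub_cancel_left, ← mul_assoc,
      div_mul_div_cancel₀ hba, div_self two_ne_zero, one_mul]
  · simp only [halfPow_of_le h]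

lemma fabExponent_halfPow {a b s y : ℝ} (hab : a < b) (hs : 0 < s) (hy : a ≤ y) :
    fabExponent a b (halfPow a b s y) = fabExponent a b y := by
  rcases lt_or_ge y ((a + b) / 2) with h | h
  · have := halfPow_lt hab hs hy h
    rw [fabExponent, fabExponent, max_eq_right (by linarith), max_eq_right (by linarith)]
  · rw [halfPow_of_le h]

lemma halfPow_eq_min_max {a b : ℝ} (hab : a < b) (s x : ℝ) :
    halfPow a b s x = a + (b - a) / 2 * (min ((2 / (b - a)) * (x - a)) 1) ^ s +
      max (x - (a + b) / 2) 0 := by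
  rcases lt_or_ge x ((a + b) / 2) with h | h
  · rw [halfPow_of_lt h, min_eq_left (rescale_lt_one hab h).le, max_eq_right (by linarith),
      add_zero]
  · have h1 : 1 ≤ (2 / (b - a)) * (x - a) := by
      rw [div_mul_eq_mul_div, one_le_div (sub_pos.2 hab)]
      linarith
    rw [halfPow_of_le h, min_eq_right h1, max_eq_left (by linarith), Real.one_rpow]
    ring

lemma continuousOn_halfPow {a b : ℝ} (hab : a < b) :
    ContinuousOn (fun p : ℝ × ℝ => halfPow a b p.1 p.2) (Ioi 0 ×ˢ univ) := by
  simp only [halfPow_eq_min_max hab]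
  have h : ContinuousOn
      (fun p : ℝ × ℝ => (min ((2 / (b - a)) * (p.2 - a)) 1) ^ p.1) (Ioi 0 ×ˢ univ) :=
    ContinuousOn.rpow (by fun_prop) (by fun_prop) fun p hp => Or.inr hp.1
  fun_prop

/-- `halfPow a b s` as a homeomorphism of `[a,b]`, with inverse `halfPow a b s⁻¹`. -/
noncomputable def halfPowHomeomorph {a b s : ℝ} (hab : a < b) (hs : 0 < s) :
    Icc a b ≃ₜ Icc a b where
  toFun x := ⟨halfPow a b s x, halfPow_mem_Icc hab hs x.2⟩
  invFun x := ⟨halfPow a b s⁻¹ x, halfPow_mem_Icc hab (inv_pos.2 hs) x.2⟩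
  left_inv x := Subtype.ext <| by
    simp only [halfPow_halfPow hab hs x.2.1, mul_inv_cancel₀ hs.ne', halfPow_one hab]
  right_inv x := Subtype.ext <| by
    simp only [halfPow_halfPow hab (inv_pos.2 hs) x.2.1, inv_mul_cancel₀ hs.ne', halfPow_one hab]
  continuous_toFun := Continuous.subtype_mk ((continuousOn_halfPow hab).comp_continuous
    (by fun_prop : Continuous fun x : Icc a b => (s, (x : ℝ))) fun _ => ⟨hs, mem_univ _⟩) _
  continuous_invFun := Continuous.subtype_mk ((continuousOn_halfPow hab).comp_continuous
    (by fun_prop : Continuous fun x : Icc a b => (s⁻¹, (x : ℝ)))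
    fun _ => ⟨inv_pos.2 hs, mem_univ _⟩) _

/-- `f_{[a,b]}` is a nontrivial topological quandle operation on `[a,b]`:
it maps `[a,b]²` into `[a,b]`, is continuous there, idempotent, right self-distributive,
its right translations are homeomorphisms of `[a,b]`, and it is not trivial. -/
theorem stmt7 (a b : ℝ) (hab : a < b) :
    (∀ x ∈ Icc a b, ∀ y ∈ Icc a b, fab a b x y ∈ Icc a b) ∧
    ContinuousOn (fun p : ℝ × ℝ => fab a b p.1 p.2) (Icc a b ×ˢ Icc a b) ∧
    (∀ x ∈ Icc a b, fab a b x x = x) ∧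
    (∀ x ∈ Icc a b, ∀ y ∈ Icc a b, ∀ z ∈ Icc a b,
      fab a b (fab a b x y) z = fab a b (fab a b x z) (fab a b y z)) ∧
    (∀ y : Icc a b, ∃ h : Icc a b ≃ₜ Icc a b, ∀ x : Icc a b, (h x : ℝ) = fab a b x y) ∧
    (∃ x₀ ∈ Icc a b, ∃ y₀ ∈ Icc a b, fab a b x₀ y₀ ≠ x₀) := by
  simp only [fab_eq_halfPow hab]
  have hpos := fabExponent_pos a b
  refine ⟨fun x hx y _ => halfPow_mem_Icc hab (hpos y) hx, ?_, fun x _ => ?_,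
    fun x hx y hy z _ => ?_, fun y => ⟨halfPowHomeomorph hab (hpos y), fun _ => rfl⟩, ?_⟩
  · have h : Continuous fun p : ℝ × ℝ => (fabExponent a b p.2, p.1) := by
      unfold fabExponent
      fun_prop
    exact ((continuousOn_halfPow hab).comp_continuous h
      fun p => ⟨hpos p.2, mem_univ _⟩).continuousOn
  · rw [← fab_eq_halfPow hab, fab, if_pos (le_total _ _)]
  · rw [fabExponent_halfPow hab (hpos z) hy.1, halfPow_halfPow hab (hpos y) hx.1,
      halfPow_halfPow hab (hpos z) hx.1, mul_comm]
  · refine ⟨(3 * a + b) / 4, ⟨by linarith, by linarith⟩, b, ⟨hab.le, le_rfl⟩, ?_⟩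
    have ht : 2 / (b - a) * ((3 * a + b) / 4 - a) = 1 / 2 := by
      have : b - a ≠ 0 := (sub_pos.2 hab).ne'
      field_simp
      ring
    have hs : 1 < fabExponent a b b := by
      rw [fabExponent, max_eq_left (by linarith)]
      linarith
    have hlt : (1 / 2 : ℝ) ^ fabExponent a b b < 1 / 2 :=
      Real.rpow_lt_self_of_lt_one (by norm_num) (by norm_num) hs
    rw [halfPow_of_lt (by linarith), ht]
    have := mul_lt_mul_of_pos_left hlt (half_pos (sub_pos.2 hab))
    exact ne_of_lt (by linarith)
end
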